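/- Let p be a prime with p ≡ 1 (mod 4) and let s : ZMod p → ℤ be the Legendre sequence. Then s is symmetric (s (−k) = s k for all k), Σ_k s k = 1, and for every k ≠ 0 the autocorrelation satisfies autocorr(s) k = −1 + 2·χ(k); in particular autocorr(s) k ∈ {−3, 1} for all k ≠ 0. -/

import Mathlib

/-- The periodic autocorrelation of a sequence `s : ZMod N → ℤ`. -/
def autocorr {N : ℕ} [NeZero N] (s : ZMod N → ℤ) : ZMod N → ℤ :=
  fun k => ∑ l : ZMod N, s l * s (l + k)

/-- The Legendre symbol as a function `ZMod p → ℤ`. -/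
def legChar (p : ℕ) [Fact p.Prime] (k : ZMod p) : ℤ := legendreSym p k.val

/-- The Legendre sequence: `1` at `0`, the Legendre symbol elsewhere. -/
def legSeq (p : ℕ) [Fact p.Prime] (k : ZMod p) : ℤ :=
  if k = 0 then 1 else legChar p k

open Finset

theorem legChar_eq_quadraticChar (p : ℕ) [Fact p.Prime] (k : ZMod p) :
    legChar p k = quadraticChar (ZMod p) k := by
  simp [legChar, legendreSym]

theorem legSeq_eq_ite_add_quadraticChar (p : ℕ) [Fact p.Prime] (k : ZMod p) :
    legSeq p k = (if k = 0 then 1 else 0) + quadraticChar (ZMod p) k := by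
  unfold legSeq
  split_ifs with h
  · simp [h]
  · simp [legChar_eq_quadraticChar]

/-- The periodic autocorrelation of the quadratic character of a finite field of odd
characteristic is `-1` away from `0`. -/
theorem quadraticChar_sum_mul_add {F : Type*} [Field F] [Fintype F] [DecidableEq F]
    (hF : ringChar F ≠ 2) {k : F} (hk : k ≠ 0) :
    ∑ l : F, quadraticChar F l * quadraticChar F (l + k) = -1 := by
  have hJ := jacobiSum_nontrivial_inv (quadraticChar_ne_one hF)
  rw [(quadraticChar_isQuadratic F).inv, jacobiSum] at hJ
  have hsq : quadraticChar F k ^ 2 = 1 := quadraticChar_sq_one hk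
  have hneg : quadraticChar F (-1) ^ 2 = 1 := quadraticChar_sq_one (neg_ne_zero.mpr one_ne_zero)
  calc ∑ l : F, quadraticChar F l * quadraticChar F (l + k)
      = ∑ x : F, quadraticChar F (-k * x) * quadraticChar F (-k * x + k) :=
        (Equiv.sum_comp (Equiv.mulLeft₀ (-k) (neg_ne_zero.mpr hk)) fun l ↦
          quadraticChar F l * quadraticChar F (l + k)).symm
    _ = ∑ x : F, quadraticChar F (-1) * (quadraticChar F x * quadraticChar F (1 - x)) := by
        refine sum_congr rfl fun x _ ↦ ?_
        rw [show -k * x = -1 * k * x by ring, show -1 * k * x + k = k * (1 - x) by ring,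
          map_mul, map_mul, map_mul]
        linear_combination quadraticChar F (-1) * quadraticChar F x * quadraticChar F (1 - x) * hsq
    _ = -1 := by
        rw [← mul_sum, hJ]
        linear_combination -hneg

theorem stmt_13 (p : ℕ) [Fact p.Prime] (h1 : p % 4 = 1) :
    (∀ k : ZMod p, legSeq p (-k) = legSeq p k) ∧
    (∑ k : ZMod p, legSeq p k) = 1 ∧
    (∀ k : ZMod p, k ≠ 0 →
      (autocorr (legSeq p) k = -1 + 2 * legChar p k ∧
        (autocorr (legSeq p) k = -3 ∨ autocorr (legSeq p) k = 1))) := by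
  have hF : ringChar (ZMod p) ≠ 2 := by
    rw [ZMod.ringChar_zmod_n]
    omega
  have hone : quadraticChar (ZMod p) (-1) = 1 := by
    rw [quadraticChar_one_iff_isSquare (neg_ne_zero.mpr one_ne_zero),
      FiniteField.isSquare_neg_one_iff, ZMod.card]
    omega
  have heven (k : ZMod p) : quadraticChar (ZMod p) (-k) = quadraticChar (ZMod p) k := by
    rw [← neg_one_mul, map_mul, hone, one_mul]
  have hauto (k : ZMod p) (hk : k ≠ 0) :
      autocorr (legSeq p) k = -1 + 2 * quadraticChar (ZMod p) k := by
    simp only [autocorr, legSeq_eq_ite_add_quadraticChar, add_mul, mul_add, sum_add_distrib,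
      quadraticChar_sum_mul_add hF hk, add_eq_zero_iff_eq_neg]
    simp [hk, heven, -quadraticChar_apply]
    ring
  refine ⟨fun k ↦ ?_, ?_, fun k hk ↦ ?_⟩
  · simp only [legSeq_eq_ite_add_quadraticChar, heven, neg_eq_zero]
  · simp [legSeq_eq_ite_add_quadraticChar, sum_add_distrib, quadraticChar_sum_zero hF,
      -quadraticChar_apply]
  · rw [hauto k hk, legChar_eq_quadraticChar]
    refine ⟨rfl, ?_⟩
    rcases quadraticChar_dichotomy hk with h | h <;> rw [h] <;> norm_num
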